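/- arXiv:1808.01692 — 10 statements merged into one kernel-verified Lean document; each statement's English description precedes it below -/
import Mathlib

section
/- Let E ⊆ Fin v × Fin f be a support pattern and d a natural number. Then I(E,d) ⊆ T(E) if and only if every polynomial in I(E,d) vanishes at the all-ones point (the point s : E → ℂ with s e = 1 for all e ∈ E). (This is the slack-matrix form of: a polytope P is morally 2-level, i.e. S_P(𝟙) lies in the slack variety, if and only if I_P ⊆ T_P.) -/
open MvPolynomial

variable {v f : ℕ}

open Classical in
/-- The symbolic slack matrix of a support pattern `E`. -/
noncomputable def symbMat (E : Set (Fin v × Fin f)) :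
    Matrix (Fin v) (Fin f) (MvPolynomial E ℂ) :=
  fun i j => if h : (i, j) ∈ E then X (⟨(i, j), h⟩ : E) else 0

/-- The ideal of `(d+2)`-minors of the symbolic slack matrix. -/
noncomputable def minorIdeal (E : Set (Fin v × Fin f)) (d : ℕ) :
    Ideal (MvPolynomial E ℂ) :=
  Ideal.span {p | ∃ (ρ : Fin (d + 2) → Fin v) (σ : Fin (d + 2) → Fin f),
    Function.Injective ρ ∧ Function.Injective σ ∧
    p = ((symbMat E).submatrix ρ σ).det}

/-- The slack-type ideal: saturation of the minor ideal by the product of all variables. -/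
noncomputable def slackIdeal (E : Set (Fin v × Fin f)) (d : ℕ) :
    Ideal (MvPolynomial E ℂ) where
  carrier := {p | ∃ k : ℕ, (∏ᶠ e : E, X e) ^ k * p ∈ minorIdeal E d}
  zero_mem' := ⟨0, by simp⟩
  add_mem' := by
    rintro p q ⟨k₁, h₁⟩ ⟨k₂, h₂⟩
    refine ⟨k₁ + k₂, ?_⟩
    have heq : (∏ᶠ e : E, (X e : MvPolynomial E ℂ)) ^ (k₁ + k₂) * (p + q) =
        (∏ᶠ e : E, (X e : MvPolynomial E ℂ)) ^ k₂ * ((∏ᶠ e : E, (X e : MvPolynomial E ℂ)) ^ k₁ * p) +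
        (∏ᶠ e : E, (X e : MvPolynomial E ℂ)) ^ k₁ * ((∏ᶠ e : E, (X e : MvPolynomial E ℂ)) ^ k₂ * q) := by
      ring
    rw [heq]
    exact Ideal.add_mem _ (Ideal.mul_mem_left _ _ h₁) (Ideal.mul_mem_left _ _ h₂)
  smul_mem' := by
    rintro a p ⟨k, h⟩
    refine ⟨k, ?_⟩
    have heq : (∏ᶠ e : E, (X e : MvPolynomial E ℂ)) ^ k * (a • p) =
        a * ((∏ᶠ e : E, (X e : MvPolynomial E ℂ)) ^ k * p) := by
      rw [smul_eq_mul]; ring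
    rw [heq]
    exact Ideal.mul_mem_left _ _ h

/-- The algebra map sending `x_{(i,j)} ↦ y_i z_j`, whose kernel is the toric ideal of the
bipartite non-incidence graph. -/
noncomputable def piE (E : Set (Fin v × Fin f)) :
    MvPolynomial E ℂ →ₐ[ℂ] MvPolynomial (Fin v ⊕ Fin f) ℂ :=
  aeval fun e => X (Sum.inl e.1.1) * X (Sum.inr e.1.2)

theorem eval_one_piE (E : Set (Fin v × Fin f)) (p : MvPolynomial E ℂ) :
    eval (fun _ : Fin v ⊕ Fin f => (1 : ℂ)) (piE E p) = eval (fun _ : E => (1 : ℂ)) p := by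
  induction p using MvPolynomial.induction_on with
  | C a => simp [piE]
  | add p q hp hq => simp [hp, hq]
  | mul_X p e hp => rw [map_mul, map_mul, hp]; simp [piE]

theorem piE_finprod_ne_zero (E : Set (Fin v × Fin f)) :
    piE E (∏ᶠ e : E, (X e : MvPolynomial E ℂ)) ≠ 0 := by
  classical
  intro h
  have h1 := eval_one_piE E (∏ᶠ e : E, (X e : MvPolynomial E ℂ))
  have : Fintype E := Fintype.ofFinite E
  rw [h, finprod_eq_prod_of_fintype] at h1
  simp at h1

/-- The image of a minor under `piE` is a monomial times the minor at the all-ones point. -/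
theorem piE_det (E : Set (Fin v × Fin f)) (n : ℕ) (ρ : Fin n → Fin v) (σ : Fin n → Fin f) :
    piE E ((symbMat E).submatrix ρ σ).det =
      (∏ i, X (Sum.inl (ρ i))) * ((∏ j, X (Sum.inr (σ j))) *
        C (eval (fun _ : E => (1 : ℂ)) ((symbMat E).submatrix ρ σ).det)) := by
  rw [RingHom.map_det, RingHom.map_det, AlgHom.map_det, ← Matrix.det_mul_row,
    ← Matrix.det_mul_column]
  congr 1
  ext1 i j
  by_cases h : (ρ i, σ j) ∈ E
  · simp [symbMat, h, piE]
  · simp [symbMat, h]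

theorem stmt0 (v f d : ℕ) (E : Set (Fin v × Fin f)) :
    slackIdeal E d ≤ RingHom.ker (piE E) ↔
      ∀ p ∈ slackIdeal E d, eval (fun _ : E => (1 : ℂ)) p = 0 := by
  constructor
  · intro h p hp
    have h0 : piE E p = 0 := h hp
    rw [← eval_one_piE, h0, map_zero]
  · rintro h p ⟨k, hk⟩
    have hJ : minorIdeal E d ≤ RingHom.ker (piE E) := by
      refine Ideal.span_le.2 ?_
      rintro q ⟨ρ, σ, hρ, hσ, rfl⟩
      have h0 := h (((symbMat E).submatrix ρ σ).det)
        ⟨0, by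
          rw [pow_zero, one_mul]
          exact Ideal.subset_span ⟨ρ, σ, hρ, hσ, rfl⟩⟩
      change piE E _ = 0
      rw [piE_det, h0, map_zero, mul_zero, mul_zero]
    have h1 : piE E ((∏ᶠ e : E, X e) ^ k * p) = 0 := hJ hk
    rw [map_mul, map_pow] at h1
    exact (mul_eq_zero.1 h1).resolve_left (pow_ne_zero _ (piE_finprod_ne_zero E))
end

section
/- Let E ⊆ Fin v × Fin f be a support pattern and d a natural number, and suppose V₊(I(E,d)) is nonempty. Then I(E,d) = T(E) if and only if both: (i) I(E,d) is toric, and (ii) any two points s, s' ∈ V₊(I(E,d)) are scaling-equivalent, i.e. there exist r : Fin v → ℝ with r i > 0 and c : Fin f → ℝ with c j > 0 such that s'(i,j) = r i * s(i,j) * c j for all (i,j) ∈ E. (This is the slack-matrix form of: the slack ideal I_P is graphic if and only if P is projectively unique and I_P is toric, where projective uniqueness of P is equivalent to the slack realization space V₊(I_P) modulo row and column scalings being a single point.) -/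
open MvPolynomial

variable {v f : ℕ}

/-- The positive part of the slack variety: positive real points at which every element of the
slack ideal vanishes. -/
noncomputable def posVariety (E : Set (Fin v × Fin f)) (d : ℕ) : Set (E → ℝ) :=
  {s | (∀ e, 0 < s e) ∧ ∀ p ∈ slackIdeal E d, eval (fun e => (s e : ℂ)) p = 0}

/-- The monomial map to the Laurent polynomial ring determined by a point configuration
`A : E → ℤ^n`, sending `x_e ↦ t^{A e}`. -/
noncomputable def laurentHom {E : Set (Fin v × Fin f)} {n : ℕ} (A : E → (Fin n → ℤ)) :
    MvPolynomial E ℂ →ₐ[ℂ] AddMonoidAlgebra ℂ (Fin n → ℤ) :=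
  aeval fun e => AddMonoidAlgebra.single (A e) 1

/-- The slack ideal is toric: it is the kernel of a monomial map to a Laurent polynomial ring. -/
def IsToric (E : Set (Fin v × Fin f)) (d : ℕ) : Prop :=
  ∃ (n : ℕ) (A : E → (Fin n → ℤ)), slackIdeal E d = RingHom.ker (laurentHom A)

/-- The exponential point attached to `A` and `x`. -/
noncomputable def expPt {E : Set (Fin v × Fin f)} {n : ℕ} (A : E → (Fin n → ℤ))
    (x : Fin n → ℝ) : E → ℝ :=
  fun e => Real.exp (∑ k, (A e k : ℝ) * x k)

/-- The character `x ↦ exp (a ⬝ x)`. -/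
noncomputable def expChar {n : ℕ} (a : Fin n → ℤ) : Multiplicative (Fin n → ℝ) →* ℂ where
  toFun x := ((Real.exp (∑ k, (a k : ℝ) * (Multiplicative.toAdd x) k) : ℝ) : ℂ)
  map_one' := by simp
  map_mul' x y := by
    rw [← Complex.ofReal_mul, ← Real.exp_add, ← Finset.sum_add_distrib]
    simp [mul_add]

theorem expChar_injective {n : ℕ} : Function.Injective (expChar (n := n)) := by
  intro a b h
  funext k
  have := DFunLike.congr_fun h (Multiplicative.ofAdd (Pi.single k 1))
  simp only [expChar, MonoidHom.coe_mk, OneHom.coe_mk, toAdd_ofAdd, Complex.ofReal_inj,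
    Real.exp_eq_exp] at this
  simpa [Pi.single_apply] using this

/-- Evaluation of Laurent polynomials at the point `exp x`. -/
noncomputable def expEval {n : ℕ} (x : Fin n → ℝ) : AddMonoidAlgebra ℂ (Fin n → ℤ) →ₐ[ℂ] ℂ :=
  AddMonoidAlgebra.lift ℂ ℂ (Fin n → ℤ)
    { toFun := fun a => ((Real.exp (∑ k, ((Multiplicative.toAdd a) k : ℝ) * x k) : ℝ) : ℂ)
      map_one' := by simp
      map_mul' := fun a b => by
        rw [← Complex.ofReal_mul, ← Real.exp_add, ← Finset.sum_add_distrib]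
        simp [add_mul] }

theorem expEval_laurentHom {E : Set (Fin v × Fin f)} {n : ℕ} (A : E → (Fin n → ℤ))
    (x : Fin n → ℝ) (p : MvPolynomial E ℂ) :
    expEval x (laurentHom A p) = eval (fun e => (expPt A x e : ℂ)) p := by
  have : (expEval x).comp (laurentHom A) = aeval (fun e => (expPt A x e : ℂ)) := by
    ext e
    simp [laurentHom, expEval, expPt]
  have h := DFunLike.congr_fun this p
  rw [AlgHom.comp_apply] at h
  rw [h, aeval_eq_eval]

theorem eq_zero_of_expEval {n : ℕ} (g : AddMonoidAlgebra ℂ (Fin n → ℤ))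
    (h : ∀ x, expEval x g = 0) : g = 0 := by
  have li := (linearIndependent_monoidHom (Multiplicative (Fin n → ℝ)) ℂ).comp
    (expChar (n := n)) expChar_injective
  rw [linearIndependent_iff] at li
  have h0 : g.coeff = 0 := by
    apply li
    rw [Finsupp.linearCombination_apply]
    funext x
    have hx := h (Multiplicative.toAdd x)
    rw [expEval, AddMonoidAlgebra.lift_apply] at hx
    rw [Finsupp.sum, Finset.sum_apply]
    exact hx
  ext a
  simp [h0]

theorem mem_ker_laurentHom_iff {E : Set (Fin v × Fin f)} {n : ℕ} (A : E → (Fin n → ℤ))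
    (p : MvPolynomial E ℂ) :
    p ∈ RingHom.ker (laurentHom A) ↔ ∀ x, eval (fun e => (expPt A x e : ℂ)) p = 0 := by
  rw [RingHom.mem_ker]
  constructor
  · intro h x
    rw [← expEval_laurentHom, h, map_zero]
  · intro h
    apply eq_zero_of_expEval
    intro x
    rw [expEval_laurentHom, h]

/-- The exponents of the bipartite graph. -/
def bipExp (E : Set (Fin v × Fin f)) : E → (Fin (v + f) → ℤ) :=
  fun e => Pi.single (Fin.castAdd f e.1.1) 1 + Pi.single (Fin.natAdd v e.1.2) 1

theorem expPt_bipExp (E : Set (Fin v × Fin f)) (x : Fin (v + f) → ℝ) (e : E) :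
    expPt (bipExp E) x e
      = Real.exp (x (Fin.castAdd f e.1.1)) * Real.exp (x (Fin.natAdd v e.1.2)) := by
  rw [← Real.exp_add, expPt]
  congr 1
  simp [bipExp, add_mul, Finset.sum_add_distrib, Pi.single_apply]

theorem eval_piE (E : Set (Fin v × Fin f)) (w : Fin v ⊕ Fin f → ℂ) (p : MvPolynomial E ℂ) :
    eval w (piE E p) = eval (fun e => w (Sum.inl e.1.1) * w (Sum.inr e.1.2)) p := by
  have : (aeval w : MvPolynomial (Fin v ⊕ Fin f) ℂ →ₐ[ℂ] ℂ).comp (piE E)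
      = aeval (fun e => w (Sum.inl e.1.1) * w (Sum.inr e.1.2)) := by
    ext e
    simp [piE]
  have h := DFunLike.congr_fun this p
  rw [AlgHom.comp_apply, aeval_eq_eval, aeval_eq_eval] at h
  exact h

theorem mem_ker_piE_iff (E : Set (Fin v × Fin f)) (p : MvPolynomial E ℂ) :
    p ∈ RingHom.ker (piE E) ↔ ∀ (r : Fin v → ℝ) (c : Fin f → ℝ), (∀ i, 0 < r i) →
      (∀ j, 0 < c j) → eval (fun e : E => ((r e.1.1 * c e.1.2 : ℝ) : ℂ)) p = 0 := by
  rw [RingHom.mem_ker]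
  constructor
  · intro h r c _ _
    have := eval_piE E (Sum.elim (fun i => (r i : ℂ)) (fun j => (c j : ℂ))) p
    rw [h, map_zero] at this
    simpa using this.symm
  · intro h
    have hinf : ((fun x : ℝ => (x : ℂ)) '' Set.Ioi 0).Infinite :=
      (Set.Ioi_infinite (0 : ℝ)).image Complex.ofReal_injective.injOn
    refine MvPolynomial.funext_set (fun _ => (fun x : ℝ => (x : ℂ)) '' Set.Ioi 0)
      (fun _ => hinf) ?_
    intro w hw
    choose y hy hyw using fun k => hw k (Set.mem_univ k)
    rw [eval_piE, map_zero]
    have := h (fun i => y (Sum.inl i)) (fun j => y (Sum.inr j)) (fun i => hy _) (fun j => hy _)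
    simp only [Complex.ofReal_mul] at this
    simp only [← hyw]
    exact this

theorem ker_piE_eq (E : Set (Fin v × Fin f)) :
    RingHom.ker (piE E) = RingHom.ker (laurentHom (bipExp E)) := by
  ext p
  rw [mem_ker_piE_iff, mem_ker_laurentHom_iff]
  constructor
  · intro h x
    simp only [expPt_bipExp]
    exact h (fun i => Real.exp (x (Fin.castAdd f i))) (fun j => Real.exp (x (Fin.natAdd v j)))
      (fun _ => Real.exp_pos _) (fun _ => Real.exp_pos _)
  · intro h r c hr hc
    have := h (Fin.append (fun i => Real.log (r i)) (fun j => Real.log (c j)))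
    simp only [expPt_bipExp, Fin.append_left, Fin.append_right, Real.exp_log (hr _),
      Real.exp_log (hc _)] at this
    exact this

theorem laurentHom_monomial {E : Set (Fin v × Fin f)} [Fintype E] {n : ℕ}
    (A : E → (Fin n → ℤ)) (w : E → ℕ) :
    laurentHom A (∏ e, X e ^ w e) = AddMonoidAlgebra.single (∑ e, (w e : ℤ) • A e) 1 := by
  classical
  rw [map_prod]
  have : ∀ s : Finset E, ∏ e ∈ s, laurentHom A (X e ^ w e)
      = AddMonoidAlgebra.single (∑ e ∈ s, (w e : ℤ) • A e) 1 := by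
    intro s
    induction s using Finset.induction_on with
    | empty => simp [AddMonoidAlgebra.one_def]
    | insert a s ha ih =>
      rw [Finset.prod_insert ha, Finset.sum_insert ha, ih]
      simp [laurentHom, AddMonoidAlgebra.single_pow, AddMonoidAlgebra.single_mul_single]
  exact this _

/-- Positive points of a toric variety are exponential points. -/
theorem exists_expPt {E : Set (Fin v × Fin f)} {n : ℕ} (A : E → (Fin n → ℤ)) (s : E → ℝ)
    (hs : ∀ e, 0 < s e)
    (h : ∀ p ∈ RingHom.ker (laurentHom A), eval (fun e => (s e : ℂ)) p = 0) :
    ∃ x, s = expPt A x := by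
  classical
  haveI : Fintype E := Fintype.ofFinite E
  let φ : (E → ℤ) →ₗ[ℤ] ℝ := Fintype.linearCombination ℤ (fun e => Real.log (s e))
  let L : (E → ℤ) →ₗ[ℤ] (Fin n → ℤ) := Fintype.linearCombination ℤ A
  have hker : LinearMap.ker L ≤ LinearMap.ker φ := by
    intro u hu
    rw [LinearMap.mem_ker] at hu ⊢
    have hsplit : ∀ e, u e = ((u e).toNat : ℤ) - ((-u e).toNat : ℤ) := fun e => by omega
    have hu' : ∑ e, ((u e).toNat : ℤ) • A e = ∑ e, ((-u e).toNat : ℤ) • A e := by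
      rw [← sub_eq_zero, ← Finset.sum_sub_distrib]
      simp only [← sub_smul, ← hsplit]
      simpa [L, Fintype.linearCombination_apply] using hu
    have hmem : (∏ e, X e ^ (u e).toNat - ∏ e, X e ^ (-u e).toNat : MvPolynomial E ℂ)
        ∈ RingHom.ker (laurentHom A) := by
      rw [RingHom.mem_ker, map_sub, laurentHom_monomial, laurentHom_monomial, hu', sub_self]
    have h1 := h _ hmem
    rw [map_sub, sub_eq_zero] at h1
    simp only [map_prod, map_pow, eval_X] at h1
    have h2 : ∏ e, s e ^ (u e).toNat = ∏ e, s e ^ (-u e).toNat := by exact_mod_cast h1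
    have h3 := congrArg Real.log h2
    rw [Real.log_prod (fun e _ => (pow_pos (hs e) _).ne'),
      Real.log_prod (fun e _ => (pow_pos (hs e) _).ne')] at h3
    simp only [Real.log_pow] at h3
    rw [← sub_eq_zero, ← Finset.sum_sub_distrib] at h3
    simp only [φ, Fintype.linearCombination_apply]
    rw [← h3]
    refine Finset.sum_congr rfl fun e _ => ?_
    conv_lhs => rw [hsplit e]
    rw [zsmul_eq_mul]
    push_cast
    ring
  haveI : Module.Injective ℤ ℝ := (Module.Baer.of_divisible ℝ).injective
  have hinj : Function.Injective ((LinearMap.ker L).liftQ L le_rfl) := by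
    rw [← LinearMap.ker_eq_bot]
    exact Submodule.ker_liftQ_eq_bot _ _ _ le_rfl
  obtain ⟨g, hg⟩ := Module.Injective.out (R := ℤ) ((LinearMap.ker L).liftQ L le_rfl) hinj
    ((LinearMap.ker L).liftQ φ hker)
  refine ⟨fun k => g (Pi.single k 1), ?_⟩
  funext e
  have h1 := hg (Submodule.Quotient.mk (Pi.single e 1))
  rw [Submodule.liftQ_apply, Submodule.liftQ_apply] at h1
  have h2 : φ (Pi.single e 1) = Real.log (s e) := by
    simp [φ]
  have h3 : L (Pi.single e 1) = A e := by
    simp [L]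
  rw [h2, h3] at h1
  have h4 : g (A e) = ∑ k, (A e k : ℝ) * g (Pi.single k 1) := by
    conv_lhs => rw [pi_eq_sum_univ' (A e)]
    rw [map_sum]
    refine Finset.sum_congr rfl fun k _ => ?_
    rw [map_zsmul, zsmul_eq_mul]
  rw [expPt, ← h4, h1, Real.exp_log (hs e)]

open Classical in
/-- The evaluated matrix. -/
noncomputable def evMat (E : Set (Fin v × Fin f)) (s : E → ℝ) : Matrix (Fin v) (Fin f) ℂ :=
  fun i j => if h : (i, j) ∈ E then (s ⟨(i, j), h⟩ : ℂ) else 0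

theorem eval_minor (E : Set (Fin v × Fin f)) {m : ℕ} (s : E → ℝ) (ρ : Fin m → Fin v)
    (σ : Fin m → Fin f) :
    eval (fun e => (s e : ℂ)) ((symbMat E).submatrix ρ σ).det
      = ((evMat E s).submatrix ρ σ).det := by
  rw [RingHom.map_det]
  congr 1
  ext i j
  simp only [RingHom.mapMatrix_apply, Matrix.map_apply, Matrix.submatrix_apply, symbMat, evMat]
  split_ifs <;> simp

theorem mem_posVariety_iff (E : Set (Fin v × Fin f)) (d : ℕ) (s : E → ℝ) :
    s ∈ posVariety E d ↔ (∀ e, 0 < s e) ∧ ∀ (ρ : Fin (d + 2) → Fin v) (σ : Fin (d + 2) → Fin f),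
      Function.Injective ρ → Function.Injective σ → ((evMat E s).submatrix ρ σ).det = 0 := by
  constructor
  · rintro ⟨hs, h⟩
    refine ⟨hs, fun ρ σ hρ hσ => ?_⟩
    rw [← eval_minor]
    apply h
    refine ⟨0, ?_⟩
    rw [pow_zero, one_mul]
    exact Ideal.subset_span ⟨ρ, σ, hρ, hσ, rfl⟩
  · rintro ⟨hs, h⟩
    refine ⟨hs, ?_⟩
    rintro p ⟨k, hk⟩
    have hle : minorIdeal E d ≤ RingHom.ker (eval (fun e => (s e : ℂ))) := by
      rw [minorIdeal, Ideal.span_le]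
      rintro q ⟨ρ, σ, hρ, hσ, rfl⟩
      rw [SetLike.mem_coe, RingHom.mem_ker, eval_minor, h ρ σ hρ hσ]
    have h1 := hle hk
    haveI : Fintype E := Fintype.ofFinite E
    rw [RingHom.mem_ker, map_mul, map_pow, finprod_eq_prod_of_fintype, map_prod] at h1
    simp only [eval_X] at h1
    refine (mul_eq_zero.1 h1).resolve_left (pow_ne_zero _ ?_)
    exact Finset.prod_ne_zero_iff.2 fun e _ => by exact_mod_cast (hs e).ne'

theorem scale_mem (E : Set (Fin v × Fin f)) (d : ℕ) (s : E → ℝ) (hs : s ∈ posVariety E d)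
    (r : Fin v → ℝ) (c : Fin f → ℝ) (hr : ∀ i, 0 < r i) (hc : ∀ j, 0 < c j) :
    (fun e : E => r e.1.1 * s e * c e.1.2) ∈ posVariety E d := by
  rw [mem_posVariety_iff] at hs ⊢
  refine ⟨fun e => mul_pos (mul_pos (hr _) (hs.1 e)) (hc _), fun ρ σ hρ hσ => ?_⟩
  have : (evMat E (fun e : E => r e.1.1 * s e * c e.1.2)).submatrix ρ σ
      = Matrix.diagonal (fun i => (r (ρ i) : ℂ)) * (evMat E s).submatrix ρ σ
        * Matrix.diagonal (fun j => (c (σ j) : ℂ)) := by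
    ext i j
    rw [Matrix.mul_diagonal, Matrix.diagonal_mul]
    simp only [Matrix.submatrix_apply, evMat]
    split_ifs <;> simp
  rw [this, Matrix.det_mul, Matrix.det_mul, hs.2 ρ σ hρ hσ, mul_zero, zero_mul]

theorem stmt1 (v f d : ℕ) (E : Set (Fin v × Fin f))
    (hne : (posVariety E d).Nonempty) :
    slackIdeal E d = RingHom.ker (piE E) ↔
      (IsToric E d ∧
        ∀ s ∈ posVariety E d, ∀ s' ∈ posVariety E d,
          ∃ (r : Fin v → ℝ) (c : Fin f → ℝ),
            (∀ i, 0 < r i) ∧ (∀ j, 0 < c j) ∧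
            ∀ e : E, s' e = r e.1.1 * s e * c e.1.2) := by
  constructor
  · intro h
    rw [ker_piE_eq] at h
    refine ⟨⟨_, _, h⟩, ?_⟩
    have key : ∀ s ∈ posVariety E d, ∃ x, s = expPt (bipExp E) x := by
      rintro s ⟨hs, hp⟩
      exact exists_expPt _ s hs (fun p hpk => hp p (h ▸ hpk))
    intro s hs s' hs'
    obtain ⟨x, rfl⟩ := key s hs
    obtain ⟨x', rfl⟩ := key s' hs'
    refine ⟨fun i => Real.exp (x' (Fin.castAdd f i) - x (Fin.castAdd f i)),
      fun j => Real.exp (x' (Fin.natAdd v j) - x (Fin.natAdd v j)),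
      fun _ => Real.exp_pos _, fun _ => Real.exp_pos _, fun e => ?_⟩
    rw [expPt_bipExp, expPt_bipExp]
    simp only [← Real.exp_add]
    congr 1
    ring
  · rintro ⟨⟨n, A, hA⟩, huniq⟩
    have hexp : ∀ x, expPt A x ∈ posVariety E d := by
      intro x
      refine ⟨fun e => Real.exp_pos _, fun p hp => ?_⟩
      rw [hA, mem_ker_laurentHom_iff] at hp
      exact hp x
    have hone : (fun _ => 1 : E → ℝ) ∈ posVariety E d := by
      have : expPt A 0 = fun _ => 1 := by
        funext e
        simp [expPt]
      exact this ▸ hexp 0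
    ext p
    rw [mem_ker_piE_iff]
    constructor
    · intro hp r c hr hc
      have := (scale_mem E d _ hone r c hr hc).2 p hp
      simpa only [mul_one] using this
    · intro hp
      rw [hA, mem_ker_laurentHom_iff]
      intro x
      obtain ⟨r, c, hr, hc, hrc⟩ := huniq _ hone _ (hexp x)
      have := hp r c hr hc
      simpa only [hrc, mul_one] using this
end

section
/- Let E ⊆ Fin 12 × Fin 34 be the support pattern of the slack matrix of the Perles polytope, given row by row as follows (rows indexed 1..12, columns 1..34; E contains (i,j) iff j appears in the list for row i): row 1: {4,5,6,14,15,16,17,18,19,20,21}; row 2: {4,7,8,9,14,15,16,17,22,23,24,25}; row 3: {7,10,11,14,15,18,19,22,26,27}; row 4: {5,12,13,16,17,20,23,24,28,29,30}; row 5: {8,10,12,22,23,26,28,29,31,32,33}; row 6: {1,11,13,18,20,27,30,34}; row 7: {2,9,24,25,30,31,34}; row 8: {3,6,19,21,26,31,32,33,34}; row 9: {1,4,8,21,25,28,32,33}; row 10: {2,5,10,14,18,19,21,27,28,29,32}; row 11: {3,7,13,16,23,24,25,27,29}; row 12: {6,9,11,12,15,17,20,22,26,30,31,33,34} (120 pairs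 in total). Then the slack ideal I(E,8) of the Perles polytope — the saturation of the ideal of 10×10 minors of the 12×34 symbolic matrix S(x) by the product of all 120 variables — is not a prime ideal of MvPolynomial E ℂ. -/
open MvPolynomial

variable {v f : ℕ}

/-- The vertex-facet non-incidences of the Perles polytope (0-indexed pairs
(vertex, facet)): the support of its slack matrix. -/
def perlesList : List (ℕ × ℕ) := [(0, 3), (0, 4), (0, 5), (0, 13), (0, 14), (0, 15), (0, 16),
  (0, 17), (0, 18), (0, 19), (0, 20), (1, 3), (1, 6), (1, 7), (1, 8), (1, 13), (1, 14), (1,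
  15), (1, 16), (1, 21), (1, 22), (1, 23), (1, 24), (2, 6), (2, 9), (2, 10), (2, 13), (2, 14),
  (2, 17), (2, 18), (2, 21), (2, 25), (2, 26), (3, 4), (3, 11), (3, 12), (3, 15), (3, 16), (3,
  19), (3, 22), (3, 23), (3, 27), (3, 28), (3, 29), (4, 7), (4, 9), (4, 11), (4, 21), (4, 22),
  (4, 25), (4, 27), (4, 28), (4, 30), (4, 31), (4, 32), (5, 0), (5, 10), (5, 12), (5, 17), (5,
  19), (5, 26), (5, 29), (5, 33), (6, 1), (6, 8), (6, 23), (6, 24), (6, 29), (6, 30), (6, 33),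
  (7, 2), (7, 5), (7, 18), (7, 20), (7, 25), (7, 30), (7, 31), (7, 32), (7, 33), (8, 0), (8,
  3), (8, 7), (8, 20), (8, 24), (8, 27), (8, 31), (8, 32), (9, 1), (9, 4), (9, 9), (9, 13), (9,
  17), (9, 18), (9, 20), (9, 26), (9, 27), (9, 28), (9, 31), (10, 2), (10, 6), (10, 12), (10,
  15), (10, 22), (10, 23), (10, 24), (10, 26), (10, 28), (11, 5), (11, 8), (11, 10), (11, 11),
  (11, 14), (11, 16), (11, 19), (11, 21), (11, 25), (11, 29), (11, 30), (11, 32), (11, 33)]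

/-- The support pattern of the slack matrix of the Perles polytope. -/
def perlesE : Set (Fin 12 × Fin 34) :=
  {p | ((p.1 : ℕ), (p.2 : ℕ)) ∈ perlesList}


/-! ## Two realizations over `ℤ[√5]` -/

/-- Rows 2, …, 10 (0-indexed) of a realization of the slack matrix over `ℤ[√5]`. -/
def slackRows : List (List (ℤ√5)) := [
  [0, 0, 0, 0, 0, 0, 1, 0, 0, 1, 1, 0, 0, 1, 1, 0, 0, ⟨-1, -1⟩, ⟨2, 0⟩, 0, 0, 1, 0, 0, 0,
   ⟨1, -1⟩, ⟨3, 1⟩, 0, 0, 0, 0, 0, 0, 0],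
  [0, 0, 0, 0, ⟨-2, 0⟩, 0, 0, 0, 0, 0, 0, 1, ⟨-1, -1⟩, 0, 0, ⟨2, 0⟩, 1, 0, 0, ⟨-1, -1⟩, 0, 0,
   ⟨2, 0⟩, ⟨-2, 0⟩, 0, 0, 0, ⟨2, 0⟩, ⟨1, 1⟩, 1, 0, 0, 0, 0],
  [0, 0, 0, 0, 0, 0, 0, 1, 0, ⟨-1, 0⟩, 0, ⟨-1, 0⟩, 0, 0, 0, 0, 0, 0, 0, 0, 0, ⟨-1, 0⟩, ⟨-3, 1⟩,
   0, 0, ⟨1, 1⟩, 0, ⟨-1, -1⟩, ⟨-2, 0⟩, 0, ⟨-2, 0⟩, ⟨3, 1⟩, ⟨1, 1⟩, 0],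
  [1, 0, 0, 0, 0, 0, 0, 0, 0, 0, ⟨-1, 0⟩, 0, ⟨-1, 1⟩, 0, 0, 0, 0, ⟨-1, 1⟩, 0, ⟨-1, 1⟩, 0, 0, 0,
   0, 0, 0, ⟨-1, -1⟩, 0, 0, ⟨-1, 0⟩, 0, 0, 0, ⟨-2, 0⟩],
  [0, 1, 0, 0, 0, 0, 0, 0, ⟨-1, 0⟩, 0, 0, 0, 0, 0, 0, 0, 0, 0, 0, 0, 0, 0, 0, ⟨-3, 1⟩, 1, 0, 0,
   0, 0, 1, ⟨-1, 1⟩, 0, 0, ⟨1, 1⟩],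
  [0, 0, 1, 0, 0, ⟨-1, 0⟩, 0, 0, 0, 0, 0, 0, 0, 0, 0, 0, 0, 0, ⟨-1, 1⟩, 0, ⟨-1, -1⟩, 0, 0, 0, 0,
   ⟨-2, 0⟩, 0, 0, 0, 0, ⟨2, 0⟩, ⟨-2, 0⟩, ⟨-2, 0⟩, ⟨2, 0⟩],
  [⟨-1, 0⟩, 0, 0, 1, 0, 0, 0, ⟨-1, 0⟩, 0, 0, 0, 0, 0, 0, 0, 0, 0, 0, 0, 0, ⟨-2, 0⟩, 0, 0, 0, 1,
   0, 0, ⟨-1, 1⟩, 0, 0, 0, ⟨-1, -1⟩, ⟨1, -1⟩, 0],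
  [0, ⟨-1, 0⟩, 0, 0, ⟨-1, 1⟩, 0, 0, 0, 0, ⟨-1, 0⟩, 0, 0, 0, ⟨-1, 0⟩, 0, 0, 0, ⟨1, 1⟩, ⟨-1, -1⟩,
   0, ⟨1, 1⟩, 0, 0, 0, 0, 0, ⟨-1, -1⟩, ⟨1, -1⟩, ⟨-3, 1⟩, 0, 0, ⟨2, 0⟩, 0, 0],
  [0, 0, ⟨-1, 0⟩, 0, 0, 0, ⟨-1, 0⟩, 0, 0, 0, 0, 0, ⟨2, 0⟩, 0, 0, ⟨1, -1⟩, 0, 0, 0, 0, 0, 0,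
   ⟨1, -1⟩, ⟨2, 0⟩, ⟨-1, 0⟩, 0, ⟨-2, 0⟩, 0, ⟨1, -1⟩, 0, 0, 0, 0, 0]]

/-- All 12 rows of the realization as combinations of the nine rows `slackRows`. -/
def coefRows : List (List (ℤ√5)) := [
  [⟨-2, 0⟩, ⟨-2, 0⟩, ⟨-2, 0⟩, ⟨-2, 0⟩, 0, ⟨-2, 0⟩, ⟨-2, 0⟩, 0, ⟨-2, 0⟩],
  [⟨-1, -1⟩, ⟨1, -1⟩, ⟨1, -1⟩, ⟨-1, -1⟩, ⟨-2, 0⟩, 0, ⟨-1, -1⟩, ⟨-2, 0⟩, 0],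
  [1, 0, 0, 0, 0, 0, 0, 0, 0],
  [0, 1, 0, 0, 0, 0, 0, 0, 0],
  [0, 0, 1, 0, 0, 0, 0, 0, 0],
  [0, 0, 0, 1, 0, 0, 0, 0, 0],
  [0, 0, 0, 0, 1, 0, 0, 0, 0],
  [0, 0, 0, 0, 0, 1, 0, 0, 0],
  [0, 0, 0, 0, 0, 0, 1, 0, 0],
  [0, 0, 0, 0, 0, 0, 0, 1, 0],
  [0, 0, 0, 0, 0, 0, 0, 0, 1],
  [⟨-2, 0⟩, ⟨1, -1⟩, 0, 0, ⟨-2, 0⟩, ⟨-2, 0⟩, 0, ⟨-2, 0⟩, ⟨-2, 0⟩]]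

/-- The left factor of the realization. -/
def matA : Matrix (Fin 12) (Fin 9) (ℤ√5) := fun i k => (coefRows.getD i []).getD k 0

/-- The right factor of the realization. -/
def matB : Matrix (Fin 9) (Fin 34) (ℤ√5) := fun k j => (slackRows.getD k []).getD j 0

/-- The realization; its rank is at most nine since it factors through `Fin 9`. -/
def matS : Matrix (Fin 12) (Fin 34) (ℤ√5) := matA * matB

/-- The support of the realization is exactly the Perles pattern. -/
lemma matS_support : ∀ (i : Fin 12) (j : Fin 34),
    matS i j ≠ 0 ↔ ((i : ℕ), (j : ℕ)) ∈ perlesList := by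
  have h : ∀ p : Fin 12 × Fin 34, matS p.1 p.2 ≠ 0 ↔ ((p.1 : ℕ), (p.2 : ℕ)) ∈ perlesList := by
    decide +kernel
  exact fun i j => h (i, j)

lemma matS_values : matS 1 3 = ⟨-1, -1⟩ ∧ matS 8 7 = ⟨-1, 0⟩ ∧ matS 1 7 = ⟨2, 0⟩ ∧
    matS 8 3 = ⟨1, 0⟩ := by
  decide +kernel

/-- Minors of size ten of a product through `Fin 9` vanish. -/
lemma det_submatrix_mul_eq_zero {K : Type*} [Field K] (A : Matrix (Fin 12) (Fin 9) K)
    (B : Matrix (Fin 9) (Fin 34) K) (ρ : Fin 10 → Fin 12) (σ : Fin 10 → Fin 34) :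
    ((A * B).submatrix ρ σ).det = 0 := by
  by_contra h
  have h1 : IsUnit ((A * B).submatrix ρ σ) :=
    (Matrix.isUnit_iff_isUnit_det _).2 (isUnit_iff_ne_zero.2 h)
  have h2 := Matrix.rank_of_isUnit _ h1
  have h3 : (A * B).submatrix ρ σ = A.submatrix ρ id * B.submatrix id σ := by
    ext i j; simp [Matrix.mul_apply]
  have h4 := Matrix.rank_mul_le_left (A.submatrix ρ id) (B.submatrix id σ)
  have h5 := Matrix.rank_le_width (A.submatrix ρ id)
  rw [← h3, h2] at h4
  simp at h4
  omega

/-- The evaluation at the realization attached to a square root `r` of five. -/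
noncomputable def evalPt (r : {r : ℂ // r * r = ((5 : ℤ) : ℂ)}) :
    MvPolynomial perlesE ℂ →ₐ[ℂ] ℂ :=
  aeval fun e => Zsqrtd.lift r (matS e.1.1 e.1.2)

lemma lift_inj (r : {r : ℂ // r * r = ((5 : ℤ) : ℂ)}) :
    Function.Injective (Zsqrtd.lift r) := by
  apply Zsqrtd.lift_injective
  intro n h
  have h1 : n ≤ 2 := by nlinarith
  have h2 : -2 ≤ n := by nlinarith
  interval_cases n <;> omega

lemma evalPt_symb (r : {r : ℂ // r * r = ((5 : ℤ) : ℂ)}) (i : Fin 12) (j : Fin 34) :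
    evalPt r (symbMat perlesE i j) = Zsqrtd.lift r (matS i j) := by
  unfold symbMat
  split_ifs with h
  · simp [evalPt]
  · have h1 : matS i j = 0 := by
      by_contra h2
      exact h ((matS_support i j).1 h2)
    simp [h1]

lemma evalPt_X_ne (r : {r : ℂ // r * r = ((5 : ℤ) : ℂ)}) (e : perlesE) :
    evalPt r (X e) ≠ 0 := by
  have h1 : matS e.1.1 e.1.2 ≠ 0 := (matS_support _ _).2 e.2
  simp only [evalPt, aeval_X]
  rw [Ne, map_eq_zero_iff _ (lift_inj r)]
  exact h1

/-- The slack ideal vanishes at both realizations. -/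
lemma evalPt_slack (r : {r : ℂ // r * r = ((5 : ℤ) : ℂ)}) {p : MvPolynomial perlesE ℂ}
    (hp : p ∈ slackIdeal perlesE 8) : evalPt r p = 0 := by
  obtain ⟨k, hk⟩ := hp
  have hJ : minorIdeal perlesE 8 ≤ RingHom.ker (evalPt r) := by
    refine Ideal.span_le.2 ?_
    rintro q ⟨ρ, σ, -, -, rfl⟩
    change evalPt r _ = 0
    rw [AlgHom.map_det]
    have : (evalPt r).mapMatrix ((symbMat perlesE).submatrix ρ σ) =
        ((matA.map (Zsqrtd.lift r)) * (matB.map (Zsqrtd.lift r))).submatrix ρ σ := by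
      rw [← Matrix.map_mul]
      ext i j
      exact evalPt_symb r (ρ i) (σ j)
    rw [this]
    exact det_submatrix_mul_eq_zero _ _ ρ σ
  have h1 : evalPt r ((∏ᶠ e : perlesE, X e) ^ k * p) = 0 := hJ hk
  rw [map_mul, map_pow, mul_eq_zero] at h1
  refine h1.resolve_left (pow_ne_zero _ ?_)
  classical
  have : Fintype perlesE := Fintype.ofFinite _
  rw [finprod_eq_prod_of_fintype, map_prod]
  exact Finset.prod_ne_zero_iff.2 fun e _ => evalPt_X_ne r e

/-! ## Matrices over a field with vanishing minors -/

/-- If all `(k+1)`-minors vanish then the rank is at most `k`. -/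
lemma rank_le_of_minors {K : Type*} [Field K] {m n k : ℕ} (M : Matrix (Fin m) (Fin n) K)
    (h : ∀ (ρ : Fin (k + 1) → Fin m) (σ : Fin (k + 1) → Fin n), Function.Injective ρ →
      Function.Injective σ → (M.submatrix ρ σ).det = 0) : M.rank ≤ k := by
  -- selecting independent rows
  have key : ∀ {a b : ℕ} (N : Matrix (Fin a) (Fin b) K), k + 1 ≤ N.rank →
      ∃ ρ : Fin (k + 1) → Fin a, Function.Injective ρ ∧
        LinearIndependent K (N.submatrix ρ id).row := by
    intro a b N hN
    rw [Matrix.rank_eq_finrank_span_row] at hN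
    obtain ⟨f, hf, -, hli⟩ := Submodule.exists_fun_fin_finrank_span_eq K (Set.range N.row)
    have hli' := hli.comp _ (Fin.castLE_injective hN)
    choose ρ hρ using fun i => hf i
    refine ⟨fun i => ρ (Fin.castLE hN i), ?_, ?_⟩
    · intro i j hij
      apply hli'.injective
      simp only [Function.comp]
      rw [← hρ, ← hρ]
      exact congrArg _ hij
    · have he : (N.submatrix (fun i => ρ (Fin.castLE hN i)) id).row = f ∘ Fin.castLE hN := by
        funext i
        simp only [Function.comp]
        rw [← hρ]
        rfl
      rw [he]
      exact hli'
  by_contra hlt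
  push Not at hlt
  obtain ⟨ρ, hρ, hli⟩ := key M hlt
  have hr : (M.submatrix ρ id).rank = k + 1 := by
    simpa using hli.rank_matrix
  obtain ⟨σ, hσ, hli2⟩ := key (M.submatrix ρ id).transpose (by rw [Matrix.rank_transpose, hr])
  have h1 := h ρ σ hρ hσ
  have h2 := Matrix.linearIndependent_rows_iff_isUnit.1 hli2
  rw [Matrix.isUnit_iff_isUnit_det, isUnit_iff_ne_zero] at h2
  apply h2
  rw [← h1, ← Matrix.det_transpose]
  rfl

/-- A `12`-row matrix of rank at most nine has a nonzero left kernel vector with two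
prescribed zeros. -/
lemma exists_kernel_vec {K : Type*} [Field K] {n : ℕ} (M : Matrix (Fin 12) (Fin n) K)
    (h : M.rank ≤ 9) (a b : Fin 12) :
    ∃ y : Fin 12 → K, y ≠ 0 ∧ y a = 0 ∧ y b = 0 ∧ ∀ j, ∑ i, y i * M i j = 0 := by
  let L : (Fin 12 → K) →ₗ[K] (LinearMap.range (Matrix.vecMulLinear M)) × (K × K) :=
    (Matrix.vecMulLinear M).rangeRestrict.prod
      ((LinearMap.proj a).prod (LinearMap.proj b))
  have hd : Module.finrank K (LinearMap.range (Matrix.vecMulLinear M)) ≤ 9 := by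
    rw [range_vecMulLinear, ← Matrix.rank_eq_finrank_span_row]
    exact h
  have hL : LinearMap.ker L ≠ ⊥ := by
    apply LinearMap.ker_ne_bot_of_finrank_lt
    simp only [Module.finrank_prod, Module.finrank_self, Module.finrank_fin_fun]
    omega
  obtain ⟨y, hy, hy0⟩ := Submodule.exists_mem_ne_zero_of_ne_bot hL
  have hy' : L y = 0 := hy
  refine ⟨y, hy0, ?_, ?_, ?_⟩
  · exact congrArg (fun z => z.2.1) hy'
  · exact congrArg (fun z => z.2.2) hy'
  · intro j
    have := congrArg (fun z => (z.1 : Fin n → K) j) hy'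
    simpa [L, Matrix.vecMul, dotProduct] using this

/-- Column relation for a column of support size three. -/
lemma col_three {K : Type*} [Field K] {M : Matrix (Fin 12) (Fin 34) K}
    (hz : ∀ (i : Fin 12) (j : Fin 34), ((i : ℕ), (j : ℕ)) ∉ perlesList → M i j = 0) {y : Fin 12 → K}
    (hy : ∀ j, ∑ i, y i * M i j = 0) (j : Fin 34) (a b c : Fin 12)
    (hne : a ≠ b ∧ a ≠ c ∧ b ≠ c)
    (hs : ∀ i : Fin 12, i ≠ a → i ≠ b → i ≠ c → ((i : ℕ), (j : ℕ)) ∉ perlesList) :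
    y a * M a j + y b * M b j + y c * M c j = 0 := by
  rw [← hy j, ← Finset.sum_subset (Finset.subset_univ {a, b, c})]
  · rw [Finset.sum_insert (by simp [hne]), Finset.sum_insert (by simp [hne]),
      Finset.sum_singleton, add_assoc]
  · intro i _ hi
    simp only [Finset.mem_insert, Finset.mem_singleton, not_or] at hi
    rw [hz i j (hs i hi.1 hi.2.1 hi.2.2), mul_zero]

/-- Column relation for a column of support size two. -/
lemma col_two {K : Type*} [Field K] {M : Matrix (Fin 12) (Fin 34) K}
    (hz : ∀ (i : Fin 12) (j : Fin 34), ((i : ℕ), (j : ℕ)) ∉ perlesList → M i j = 0) {y : Fin 12 → K}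
    (hy : ∀ j, ∑ i, y i * M i j = 0) (j : Fin 34) (a b : Fin 12)
    (hne : a ≠ b)
    (hs : ∀ i : Fin 12, i ≠ a → i ≠ b → ((i : ℕ), (j : ℕ)) ∉ perlesList) :
    y a * M a j + y b * M b j = 0 := by
  rw [← hy j, ← Finset.sum_subset (Finset.subset_univ {a, b})]
  · rw [Finset.sum_insert (by simp [hne]), Finset.sum_singleton]
  · intro i _ hi
    simp only [Finset.mem_insert, Finset.mem_singleton, not_or] at hi
    rw [hz i j (hs i hi.1 hi.2), mul_zero]

/-- A left kernel vector, described through the columns of support size two and three. -/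
lemma kernel_relations {K : Type*} [Field K] {M : Matrix (Fin 12) (Fin 34) K}
    (hz : ∀ (i : Fin 12) (j : Fin 34), ((i : ℕ), (j : ℕ)) ∉ perlesList → M i j = 0) {y : Fin 12 → K}
    (hy : ∀ j, ∑ i, y i * M i j = 0) :
    (y 5 * M 5 0 + y 8 * M 8 0 = 0 ∧ y 6 * M 6 1 + y 9 * M 9 1 = 0 ∧
      y 7 * M 7 2 + y 10 * M 10 2 = 0) ∧
    (y 0 * M 0 3 + y 1 * M 1 3 + y 8 * M 8 3 = 0 ∧
      y 0 * M 0 4 + y 3 * M 3 4 + y 9 * M 9 4 = 0 ∧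
      y 0 * M 0 5 + y 7 * M 7 5 + y 11 * M 11 5 = 0 ∧
      y 1 * M 1 6 + y 2 * M 2 6 + y 10 * M 10 6 = 0 ∧
      y 1 * M 1 7 + y 4 * M 4 7 + y 8 * M 8 7 = 0 ∧
      y 1 * M 1 8 + y 6 * M 6 8 + y 11 * M 11 8 = 0) ∧
    (y 2 * M 2 9 + y 4 * M 4 9 + y 9 * M 9 9 = 0 ∧
      y 2 * M 2 10 + y 5 * M 5 10 + y 11 * M 11 10 = 0 ∧
      y 3 * M 3 11 + y 4 * M 4 11 + y 11 * M 11 11 = 0 ∧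
      y 3 * M 3 12 + y 5 * M 5 12 + y 10 * M 10 12 = 0) :=
  ⟨⟨col_two hz hy 0 5 8 (by decide) (by decide), col_two hz hy 1 6 9 (by decide) (by decide),
    col_two hz hy 2 7 10 (by decide) (by decide)⟩,
   ⟨col_three hz hy 3 0 1 8 (by decide) (by decide),
    col_three hz hy 4 0 3 9 (by decide) (by decide),
    col_three hz hy 5 0 7 11 (by decide) (by decide),
    col_three hz hy 6 1 2 10 (by decide) (by decide),
    col_three hz hy 7 1 4 8 (by decide) (by decide),
    col_three hz hy 8 1 6 11 (by decide) (by decide)⟩,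
   ⟨col_three hz hy 9 2 4 9 (by decide) (by decide),
    col_three hz hy 10 2 5 11 (by decide) (by decide),
    col_three hz hy 11 3 4 11 (by decide) (by decide),
    col_three hz hy 12 3 5 10 (by decide) (by decide)⟩⟩

/-- Two-term relations propagate zeros. -/
lemma zero_of_rel {K : Type*} [Field K] {a b c p q r : K} (h : a * p + b * q + c * r = 0)
    (ha : a = 0) (hb : b = 0) (hr : r ≠ 0) : c = 0 := by
  subst ha hb
  simpa [hr] using h

/-- A kernel vector is determined by its entries `0`, `1`, `11`. -/
lemma kernel_zero {K : Type*} [Field K] {M : Matrix (Fin 12) (Fin 34) K}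
    (hz : ∀ (i : Fin 12) (j : Fin 34), ((i : ℕ), (j : ℕ)) ∉ perlesList → M i j = 0)
    (hn : ∀ (i : Fin 12) (j : Fin 34), ((i : ℕ), (j : ℕ)) ∈ perlesList → M i j ≠ 0) {y : Fin 12 → K}
    (hy : ∀ j, ∑ i, y i * M i j = 0) (h0 : y 0 = 0) (h1 : y 1 = 0) (h11 : y 11 = 0) :
    y = 0 := by
  obtain ⟨⟨c0, c1, c2⟩, ⟨c3, c4, c5, c6, c7, c8⟩, -⟩ := kernel_relations hz hy
  have h8 : y 8 = 0 := zero_of_rel c3 h0 h1 (hn 8 3 (by decide))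
  have h5 : y 5 = 0 := by
    simpa [h8, hn 5 0 (by decide)] using c0
  have h4 : y 4 = 0 := by
    simpa [h8, h1, hn 4 7 (by decide)] using c7
  have h7 : y 7 = 0 := by
    simpa [h0, h11, hn 7 5 (by decide)] using c5
  have h10 : y 10 = 0 := by
    simpa [h7, hn 10 2 (by decide)] using c2
  have h2 : y 2 = 0 := by
    simpa [h1, h10, hn 2 6 (by decide)] using c6
  have h6 : y 6 = 0 := by
    simpa [h1, h11, hn 6 8 (by decide)] using c8
  have h9 : y 9 = 0 := by
    simpa [h6, hn 9 1 (by decide)] using c1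
  have h3 : y 3 = 0 := by
    simpa [h0, h9, hn 3 4 (by decide)] using c4
  funext i
  fin_cases i <;> assumption

/-- In a two-term relation, the second unknown is nonzero if the first one is. -/
lemma ne_of_rel {K : Type*} [Field K] {a b p q : K} (h : a * p + b * q = 0)
    (ha : a ≠ 0) (hp : p ≠ 0) : b ≠ 0 := by
  rintro rfl
  simp [ha, hp] at h

/-- Two parallel two-term relations yield proportionality. -/
lemma prop_of_rel {K : Type*} [Field K] {a b a' b' p q : K} (h : a * p + b * q = 0)
    (h' : a' * p + b' * q = 0) (hp : p ≠ 0) : a * b' = a' * b := by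
  apply mul_left_cancel₀ hp
  linear_combination b' * h - b * h'

/-- The core computation: the quadratic relation forced by the Perles configuration. -/
lemma core_relation {K : Type*} [Field K] {M : Matrix (Fin 12) (Fin 34) K}
    (hz : ∀ (i : Fin 12) (j : Fin 34), ((i : ℕ), (j : ℕ)) ∉ perlesList → M i j = 0)
    (hn : ∀ (i : Fin 12) (j : Fin 34), ((i : ℕ), (j : ℕ)) ∈ perlesList → M i j ≠ 0) (hr : M.rank ≤ 9) :
    (M 1 3 * M 8 7) ^ 2 - (M 1 3 * M 8 7) * (M 1 7 * M 8 3) - (M 1 7 * M 8 3) ^ 2 = 0 := by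
  obtain ⟨y, hy0, y1, y11, hy⟩ := exists_kernel_vec M hr 1 11
  obtain ⟨z, hz0, z0, z11, hzz⟩ := exists_kernel_vec M hr 0 11
  obtain ⟨t, ht0, t0, t1, ht⟩ := exists_kernel_vec M hr 0 1
  have y0 : y 0 ≠ 0 := fun h => hy0 (kernel_zero hz hn hy h y1 y11)
  have z1 : z 1 ≠ 0 := fun h => hz0 (kernel_zero hz hn hzz z0 h z11)
  have t11 : t 11 ≠ 0 := fun h => ht0 (kernel_zero hz hn ht t0 t1 h)
  obtain ⟨⟨a0, a1, a2⟩, ⟨a3, a4, a5, a6, a7, a8⟩, a9, a10, a11, a12⟩ := kernel_relations hz hy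
  obtain ⟨⟨b0, b1, b2⟩, ⟨b3, b4, b5, b6, b7, b8⟩, b9, b10, b11, b12⟩ := kernel_relations hz hzz
  obtain ⟨⟨c0, c1, c2⟩, ⟨c3, c4, c5, c6, c7, c8⟩, c9, c10, c11, c12⟩ := kernel_relations hz ht
  simp only [y1, y11, z0, z11, t0, t1, zero_mul, zero_add, add_zero] at *
  -- entries that vanish
  have y6 : y 6 = 0 := by simpa [hn 6 8 (by decide)] using a8
  have y9 : y 9 = 0 := by simpa [y6, hn 9 1 (by decide)] using a1
  have z7 : z 7 = 0 := by simpa [hn 7 5 (by decide)] using b5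
  have z10 : z 10 = 0 := by simpa [z7, hn 10 2 (by decide)] using b2
  have t8 : t 8 = 0 := by simpa [hn 8 3 (by decide)] using c3
  have t5 : t 5 = 0 := by simpa [t8, hn 5 0 (by decide)] using c0
  have t4 : t 4 = 0 := by simpa [t8, hn 4 7 (by decide)] using c7
  simp only [y6, y9, z7, z10, t8, t5, t4, zero_mul, add_zero] at *
  -- entries that do not vanish
  have y8 := ne_of_rel a3 y0 (hn 0 3 (by decide))
  have y5 := ne_of_rel ((add_comm _ _).trans a0) y8 (hn 8 0 (by decide))
  have y4 := ne_of_rel ((add_comm _ _).trans a7) y8 (hn 8 7 (by decide))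
  have y7 := ne_of_rel a5 y0 (hn 0 5 (by decide))
  have y10 := ne_of_rel a2 y7 (hn 7 2 (by decide))
  have y2 := ne_of_rel ((add_comm _ _).trans a6) y10 (hn 10 6 (by decide))
  have y3 := ne_of_rel a4 y0 (hn 0 4 (by decide))
  have z6 := ne_of_rel b8 z1 (hn 1 8 (by decide))
  have z9 := ne_of_rel b1 z6 (hn 6 1 (by decide))
  have t6 := ne_of_rel ((add_comm _ _).trans c8) t11 (hn 11 8 (by decide))
  have t9 := ne_of_rel c1 t6 (hn 6 1 (by decide))
  -- proportionalities
  have p1 : y 5 * z 8 = z 5 * y 8 := prop_of_rel a0 b0 (hn 5 0 (by decide))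
  have p2 : y 2 * z 5 = z 2 * y 5 := prop_of_rel a10 b10 (hn 2 10 (by decide))
  have p3 : y 3 * z 4 = z 3 * y 4 := prop_of_rel a11 b11 (hn 3 11 (by decide))
  have p4 : y 2 * t 10 = t 2 * y 10 := prop_of_rel a6 c6 (hn 2 6 (by decide))
  have p5 : z 3 * t 9 = t 3 * z 9 := prop_of_rel b4 c4 (hn 3 4 (by decide))
  -- the two remaining collinearities
  have d1 : y 2 * z 4 * t 9 - z 2 * y 4 * t 9 + t 2 * y 4 * z 9 = 0 := by
    apply mul_left_cancel₀ (hn 2 9 (by decide))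
    linear_combination (z 4 * t 9) * a9 - (y 4 * t 9) * b9 + (y 4 * z 9) * c9
  have d2 : y 3 * z 5 * t 10 - z 3 * y 5 * t 10 - t 3 * z 5 * y 10 = 0 := by
    apply mul_left_cancel₀ (hn 3 12 (by decide))
    linear_combination (z 5 * t 10) * a12 - (y 5 * t 10) * b12 - (z 5 * y 10) * c12
  -- affine coordinates
  obtain ⟨s, hs⟩ : ∃ s, z 5 = s * y 5 := ⟨z 5 / y 5, by field_simp⟩
  obtain ⟨τ, hτ⟩ : ∃ τ, z 4 = τ * y 4 := ⟨z 4 / y 4, by field_simp⟩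
  obtain ⟨φ, hφ⟩ : ∃ φ, t 10 = φ * y 10 := ⟨t 10 / y 10, by field_simp⟩
  obtain ⟨η, hη⟩ : ∃ η, t 9 = η * z 9 := ⟨t 9 / z 9, by field_simp⟩
  have η0 : η ≠ 0 := by
    rintro rfl
    exact t9 (by simpa using hη)
  have z8 : z 8 = s * y 8 := by
    apply mul_left_cancel₀ y5
    linear_combination p1 + y 8 * hs
  have z2 : z 2 = s * y 2 := by
    apply mul_right_cancel₀ y5
    linear_combination -p2 + y 2 * hs
  have z3 : z 3 = τ * y 3 := by
    apply mul_right_cancel₀ y4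
    linear_combination -p3 + y 3 * hτ
  have t2 : t 2 = φ * y 2 := by
    apply mul_right_cancel₀ y10
    linear_combination -p4 + y 2 * hφ
  have t3 : t 3 = η * z 3 := by
    apply mul_right_cancel₀ z9
    linear_combination -p5 + z 3 * hη
  have e1 : τ * η - s * η + φ = 0 := by
    apply mul_left_cancel₀ (mul_ne_zero (mul_ne_zero y2 y4) z9)
    rw [hτ, hη, z2, t2] at d1
    linear_combination d1
  have e2 : s * φ - τ * φ - τ * η * s = 0 := by
    apply mul_left_cancel₀ (mul_ne_zero (mul_ne_zero y3 y5) y10)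
    rw [t3, z3, hs, hφ] at d2
    linear_combination d2
  have e3 : (s - τ) ^ 2 = s * τ := by
    apply mul_left_cancel₀ η0
    linear_combination e2 - (s - τ) * e1
  -- express everything through the matrix entries
  have f1 : s * y 8 * M 8 3 = - (z 1 * M 1 3) := by
    rw [z8] at b3
    linear_combination b3
  have f2 : (s - τ) * y 8 * M 8 7 = - (z 1 * M 1 7) := by
    rw [z8, hτ] at b7
    linear_combination b7 - τ * a7
  have m83 := hn 8 3 (by decide)
  have m87 := hn 8 7 (by decide)
  apply mul_left_cancel₀ (pow_ne_zero 2 z1)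
  have g1 : z 1 * M 1 3 = -(s * y 8 * M 8 3) := by rw [f1, neg_neg]
  have g2 : z 1 * M 1 7 = -((s - τ) * y 8 * M 8 7) := by rw [f2, neg_neg]
  calc _ = (z 1 * M 1 3) ^ 2 * M 8 7 ^ 2 - (z 1 * M 1 3) * (z 1 * M 1 7) * M 8 7 * M 8 3
        - (z 1 * M 1 7) ^ 2 * M 8 3 ^ 2 := by ring
    _ = _ := by
      rw [g1, g2]
      linear_combination (-(y 8 * M 8 3 * M 8 7) ^ 2) * e3

/-! ## The main theorem -/

lemma slack_prime_false (hP : (slackIdeal perlesE 8).IsPrime) : False := by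
  obtain ⟨r, hr⟩ : ∃ r : ℂ, r * r = 5 := by
    obtain ⟨r, hr⟩ := IsAlgClosed.exists_pow_nat_eq (5 : ℂ) (n := 2) (by norm_num)
    exact ⟨r, by rw [← hr]; ring⟩
  have hr0 : r ≠ 0 := by
    rintro rfl
    norm_num at hr
  let rp : {r : ℂ // r * r = ((5 : ℤ) : ℂ)} := ⟨r, by simpa using hr⟩
  let rm : {r : ℂ // r * r = ((5 : ℤ) : ℂ)} := ⟨-r, by simpa using hr⟩
  set I := slackIdeal perlesE 8 with hI
  let K := FractionRing (MvPolynomial perlesE ℂ ⧸ I)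
  let π : MvPolynomial perlesE ℂ →+* K :=
    (algebraMap (MvPolynomial perlesE ℂ ⧸ I) K).comp (Ideal.Quotient.mk I)
  have hπ : ∀ p, π p = 0 ↔ p ∈ I := by
    intro p
    rw [← Ideal.Quotient.eq_zero_iff_mem]
    exact map_eq_zero_iff _ (IsFractionRing.injective (MvPolynomial perlesE ℂ ⧸ I) K)
  let M : Matrix (Fin 12) (Fin 34) K := (symbMat perlesE).map π
  have hz : ∀ (i : Fin 12) (j : Fin 34), ((i : ℕ), (j : ℕ)) ∉ perlesList → M i j = 0 := by
    intro i j h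
    have h' : (i, j) ∉ perlesE := h
    simp [M, symbMat, h']
  have hn : ∀ (i : Fin 12) (j : Fin 34), ((i : ℕ), (j : ℕ)) ∈ perlesList → M i j ≠ 0 := by
    intro i j h h0
    have h1 : symbMat perlesE i j ∈ I := (hπ _).1 h0
    have h2 := evalPt_slack rp h1
    rw [evalPt_symb, map_eq_zero_iff _ (lift_inj rp)] at h2
    exact (matS_support i j).2 h h2
  have hrank : M.rank ≤ 9 := by
    apply rank_le_of_minors
    intro ρ σ hρ hσ
    have h1 : ((symbMat perlesE).submatrix ρ σ).det ∈ I :=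
      ⟨0, by
        rw [pow_zero, one_mul]
        exact Ideal.subset_span ⟨ρ, σ, hρ, hσ, rfl⟩⟩
    have h2 := (hπ _).2 h1
    rw [RingHom.map_det] at h2
    exact h2
  have hcore := core_relation hz hn hrank
  set U := symbMat perlesE 1 3 * symbMat perlesE 8 7 with hU
  set V := symbMat perlesE 1 7 * symbMat perlesE 8 3 with hV
  have hmem : (U - C ((1 + r) / 2) * V) * (U - C ((1 - r) / 2) * V) ∈ I := by
    have h1 : (U - C ((1 + r) / 2) * V) * (U - C ((1 - r) / 2) * V) =
        U ^ 2 - U * V - V ^ 2 := by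
      have h2 : (C ((1 + r) / 2) + C ((1 - r) / 2) : MvPolynomial perlesE ℂ) = 1 := by
        rw [← C_add, ← C_1]
        congr 1
        ring
      have h3 : (C ((1 + r) / 2) * C ((1 - r) / 2) : MvPolynomial perlesE ℂ) = -1 := by
        rw [← C_mul, ← C_1, ← C_neg]
        congr 1
        linear_combination (-1 / 4) * hr
      linear_combination (-U * V) * h2 + V ^ 2 * h3
    rw [h1, ← hπ]
    simpa [M, hU, hV] using hcore
  obtain ⟨v13, v87, v17, v83⟩ := matS_values
  have hev : ∀ q : {r : ℂ // r * r = ((5 : ℤ) : ℂ)}, evalPt q U = 1 + q.1 ∧ evalPt q V = 2 := by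
    intro q
    rw [hU, hV, map_mul, map_mul]
    simp only [evalPt_symb, v13, v87, v17, v83, Zsqrtd.lift]
    constructor
    · simp
      ring
    · simp
  have hC : ∀ (q : {r : ℂ // r * r = ((5 : ℤ) : ℂ)}) (c : ℂ), evalPt q (C c) = c := by
    intro q c
    simp [evalPt]
  clear_value U V
  rcases hP.mem_or_mem hmem with h | h
  · have h1 := evalPt_slack rm h
    rw [map_sub, map_mul, (hev rm).1, (hev rm).2, hC] at h1
    apply hr0
    have h2 : rm.1 = -r := rfl
    rw [h2] at h1
    linear_combination (-1 / 2) * h1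
  · have h1 := evalPt_slack rp h
    rw [map_sub, map_mul, (hev rp).1, (hev rp).2, hC] at h1
    apply hr0
    have h2 : rp.1 = r := rfl
    rw [h2] at h1
    linear_combination (1 / 2) * h1

/-- The slack ideal of the Perles polytope (an 8-polytope, so we saturate the ideal of
10×10 minors) is not prime. -/
theorem stmt2 : ¬ (slackIdeal perlesE 8).IsPrime := by
  exact fun h => slack_prime_false h
end

section
/- Let A : Matrix (Fin d) (Fin n) ℤ be an integer matrix with columns a_1, …, a_n, and let u, v : Fin n → ℕ. If for every t : Fin d → ℝ with t i > 0 for all i one has ∏_{j} (∏_{i} (t i)^{A i j})^{u j} = ∏_{j} (∏_{i} (t i)^{A i j})^{v j} (integer exponents taken as zpow), then A·u = A·v, i.e. for every i, ∑_{j} A i j * (u j : ℤ) = ∑_{j} A i j * (v j : ℤ). -/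
/-- If the pure difference binomial `x^u − x^v` vanishes on the image of the positive real
torus under the monomial map `φ_A`, then `A·u = A·v`. -/
theorem stmt4 (d n : ℕ) (A : Matrix (Fin d) (Fin n) ℤ) (u v : Fin n → ℕ)
    (h : ∀ t : Fin d → ℝ, (∀ i, 0 < t i) →
      ∏ j, (∏ i, t i ^ A i j) ^ u j = ∏ j, (∏ i, t i ^ A i j) ^ v j) :
    ∀ i, ∑ j, A i j * (u j : ℤ) = ∑ j, A i j * (v j : ℤ) := by
  intro k
  have key := h (fun i => Real.exp (if i = k then 1 else 0)) (fun i => Real.exp_pos _)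
  have e : ∀ w : Fin n → ℕ,
      ∏ j, (∏ i, Real.exp (if i = k then 1 else 0) ^ A i j) ^ w j
        = Real.exp (∑ j, (A k j : ℝ) * (w j : ℝ)) := by
    intro w
    rw [Real.exp_sum]
    refine Finset.prod_congr rfl fun j _ => ?_
    have h1 : ∏ i, Real.exp (if i = k then 1 else 0) ^ A i j = Real.exp (A k j : ℝ) := by
      rw [Finset.prod_eq_single k]
      · rw [if_pos rfl, ← Real.rpow_intCast, ← Real.exp_mul, one_mul]
      · intro b _ hb; simp [hb]
      · simp
    rw [h1, ← Real.exp_nat_mul, mul_comm]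
  have key2 := (e u).symm.trans (key.trans (e v))
  have := Real.exp_injective key2
  exact_mod_cast this
end

section
/- Let A : Matrix (Fin d) (Fin n) ℤ and u, v : Fin n → ℕ. If for every t : Fin d → ℝ with t i > 0 for all i one has ∏_{j} (∏_{i} (t i)^{A i j})^{u j} = ∏_{j} (∏_{i} (t i)^{A i j})^{v j}, then the same equality holds for every t : Fin d → ℂ with t i ≠ 0 for all i; equivalently, the binomial x^u − x^v lies in the toric ideal of A, the kernel of the ℂ-algebra homomorphism MvPolynomial (Fin n) ℂ → AddMonoidAlgebra ℂ (Fin d → ℤ) sending x_j to the Laurent monomial t^{a_j} with exponent vector the j-th column of A. -/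
open MvPolynomial

/-- The monomial map to the Laurent polynomial ring determined by the columns of an integer
matrix `A`, sending `x_j ↦ t^{a_j}` where `a_j` is the `j`-th column of `A`. -/
noncomputable def toricHom (d n : ℕ) (A : Matrix (Fin d) (Fin n) ℤ) :
    MvPolynomial (Fin n) ℂ →ₐ[ℂ] AddMonoidAlgebra ℂ (Fin d → ℤ) :=
  aeval fun j => AddMonoidAlgebra.single (fun i => A i j) 1

/-- Rewriting the product as a monomial in `t`. -/
theorem stmt5_aux {K : Type*} [Field K] (d n : ℕ) (A : Matrix (Fin d) (Fin n) ℤ)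
    (w : Fin n → ℕ) (t : Fin d → K) (ht : ∀ i, t i ≠ 0) :
    ∏ j, (∏ i, t i ^ A i j) ^ w j = ∏ i, t i ^ (∑ j, (w j : ℤ) * A i j) := by
  have hs : ∀ (a : K) (ha : a ≠ 0) (s : Finset (Fin n)) (f : Fin n → ℤ),
      a ^ (∑ j ∈ s, f j) = ∏ j ∈ s, a ^ f j := by
    intro a ha s f
    induction s using Finset.induction_on with
    | empty => simp
    | insert x s hx ih => rw [Finset.sum_insert hx, Finset.prod_insert hx, zpow_add₀ ha, ih]
  simp_rw [← Finset.prod_pow]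
  rw [Finset.prod_comm]
  refine Finset.prod_congr rfl fun i _ => ?_
  rw [hs _ (ht i)]
  refine Finset.prod_congr rfl fun j _ => ?_
  rw [mul_comm, zpow_mul, zpow_natCast]

theorem stmt5_aux2 (d n : ℕ) (A : Matrix (Fin d) (Fin n) ℤ) (w : Fin n → ℕ) :
    toricHom d n A (∏ j, (X j : MvPolynomial (Fin n) ℂ) ^ w j) =
      AddMonoidAlgebra.single (fun i => ∑ j, (w j : ℤ) * A i j) 1 := by
  have hs : ∀ (s : Finset (Fin n)),
      ∏ j ∈ s, (AddMonoidAlgebra.single (fun i => A i j) (1 : ℂ)) ^ w j =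
      AddMonoidAlgebra.single (fun i => ∑ j ∈ s, (w j : ℤ) * A i j) 1 := by
    intro s
    induction s using Finset.induction_on with
    | empty => simp [AddMonoidAlgebra.one_def]; rfl
    | insert x s hx ih =>
      rw [Finset.prod_insert hx, ih, AddMonoidAlgebra.single_pow,
        AddMonoidAlgebra.single_mul_single]
      congr 1
      · funext i
        simp [Finset.sum_insert hx]
      · simp
  rw [map_prod, ← hs]
  simp [toricHom]

/-- If the pure difference binomial `x^u − x^v` vanishes on the image of the positive real
torus under the monomial map `φ_A`, then it also vanishes on the image of the whole complex
torus; equivalently, `x^u − x^v` lies in the toric ideal of `A`. -/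
theorem stmt5 (d n : ℕ) (A : Matrix (Fin d) (Fin n) ℤ) (u v : Fin n → ℕ)
    (h : ∀ t : Fin d → ℝ, (∀ i, 0 < t i) →
      ∏ j, (∏ i, t i ^ A i j) ^ u j = ∏ j, (∏ i, t i ^ A i j) ^ v j) :
    (∀ t : Fin d → ℂ, (∀ i, t i ≠ 0) →
      ∏ j, (∏ i, t i ^ A i j) ^ u j = ∏ j, (∏ i, t i ^ A i j) ^ v j) ∧
    ((∏ j, (X j : MvPolynomial (Fin n) ℂ) ^ u j) - ∏ j, (X j : MvPolynomial (Fin n) ℂ) ^ v j)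
      ∈ RingHom.ker (toricHom d n A) := by
  have key : ∀ k, ∑ j, (u j : ℤ) * A k j = ∑ j, (v j : ℤ) * A k j := by
    intro k
    have hpos : ∀ i, 0 < (fun i => if i = k then (2 : ℝ) else 1) i := by
      intro i
      dsimp only
      split_ifs <;> norm_num
    have h1 := h _ hpos
    rw [stmt5_aux d n A u _ fun i => (hpos i).ne', stmt5_aux d n A v _ fun i => (hpos i).ne'] at h1
    simp only [ite_pow, one_zpow, Finset.prod_ite_eq', Finset.mem_univ, if_true] at h1
    exact zpow_right_injective₀ (by norm_num) (by norm_num) h1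
  constructor
  · intro t ht
    rw [stmt5_aux d n A u t ht, stmt5_aux d n A v t ht]
    simp_rw [key]
  · rw [RingHom.mem_ker, map_sub, stmt5_aux2, stmt5_aux2]
    simp_rw [key]
    exact sub_self _
end

section
/- Let E ⊆ Fin v × Fin f be a support pattern and d a natural number. Suppose there exists a point s : E → ℝ with s e > 0 for all e ∈ E at which every (d+2)-minor of S(x) vanishes. If a, b : E → ℕ and the pure difference binomial x^a − x^b := (∏_{e} x_e^{a e}) − (∏_{e} x_e^{b e}) belongs to I(E,d), then x^a − x^b belongs to T(E), i.e. π(∏_e x_e^{a e}) = π(∏_e x_e^{b e}). -/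
open MvPolynomial

variable {v f : ℕ}

/-- The torus-scaled positive point, as a map `x_{(i,j)} ↦ s_{ij} y_i z_j`. -/
noncomputable def phiS (E : Set (Fin v × Fin f)) (s : E → ℝ) :
    MvPolynomial E ℂ →ₐ[ℂ] MvPolynomial (Fin v ⊕ Fin f) ℂ :=
  aeval fun e => C (s e : ℂ) * (X (Sum.inl e.1.1) * X (Sum.inr e.1.2))

theorem phiS_det (E : Set (Fin v × Fin f)) (s : E → ℝ) (n : ℕ)
    (ρ : Fin n → Fin v) (σ : Fin n → Fin f) :
    phiS E s ((symbMat E).submatrix ρ σ).det =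
      (∏ i, X (Sum.inl (ρ i))) * ((∏ j, X (Sum.inr (σ j))) *
        C (eval (fun e => (s e : ℂ)) ((symbMat E).submatrix ρ σ).det)) := by
  have h1 : (C : ℂ →+* MvPolynomial (Fin v ⊕ Fin f) ℂ)
      (eval (fun e => (s e : ℂ)) ((symbMat E).submatrix ρ σ).det) =
      (((symbMat E).submatrix ρ σ).map
        (fun p => (C : ℂ →+* MvPolynomial (Fin v ⊕ Fin f) ℂ) (eval (fun e => (s e : ℂ)) p))).det := by
    rw [RingHom.map_det, RingHom.map_det]
    rfl
  rw [h1, ← Matrix.det_mul_row, ← Matrix.det_mul_column, AlgHom.map_det]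
  congr 1
  ext1 i j
  simp only [AlgHom.mapMatrix_apply, Matrix.map_apply, Matrix.submatrix_apply, Matrix.of_apply,
    symbMat]
  split_ifs with h
  · simp [phiS]; ring
  · simp

theorem phiS_prod (E : Set (Fin v × Fin f)) [Fintype E] (s : E → ℝ) (a : E → ℕ) :
    phiS E s (∏ e : E, (X e : MvPolynomial E ℂ) ^ a e) =
      C (∏ e : E, (s e : ℂ) ^ a e) * piE E (∏ e : E, (X e : MvPolynomial E ℂ) ^ a e) := by
  simp [phiS, piE, map_prod, mul_pow, Finset.prod_mul_distrib]

/-- If there is a positive real point at which every `(d+2)`-minor of the symbolic slack matrix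
vanishes (an actual slack matrix), then every pure difference binomial in the slack ideal lies
in the toric ideal of the non-incidence graph. -/
theorem stmt6 (v f d : ℕ) (E : Set (Fin v × Fin f)) (s : E → ℝ)
    (hpos : ∀ e, 0 < s e)
    (hvan : ∀ (ρ : Fin (d + 2) → Fin v) (σ : Fin (d + 2) → Fin f),
      Function.Injective ρ → Function.Injective σ →
      eval (fun e => (s e : ℂ)) ((symbMat E).submatrix ρ σ).det = 0)
    (a b : E → ℕ)
    (hmem : (∏ᶠ e : E, (X e : MvPolynomial E ℂ) ^ a e) - (∏ᶠ e : E, (X e : MvPolynomial E ℂ) ^ b e)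
      ∈ slackIdeal E d) :
    piE E (∏ᶠ e : E, (X e : MvPolynomial E ℂ) ^ a e)
      = piE E (∏ᶠ e : E, (X e : MvPolynomial E ℂ) ^ b e) := by
  classical
  haveI : Fintype E := Fintype.ofFinite E
  simp only [finprod_eq_prod_of_fintype] at hmem ⊢
  obtain ⟨k, hk⟩ := hmem
  rw [finprod_eq_prod_of_fintype] at hk
  have hker : minorIdeal E d ≤ RingHom.ker (phiS E s) := by
    refine Ideal.span_le.2 ?_
    rintro p ⟨ρ, σ, hρ, hσ, rfl⟩
    change phiS E s _ = 0
    rw [phiS_det, hvan ρ σ hρ hσ]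
    simp
  have h0 := hker hk
  rw [RingHom.mem_ker, map_mul, map_pow] at h0
  have hm : phiS E s (∏ e : E, (X e : MvPolynomial E ℂ)) ≠ 0 := by
    rw [map_prod]
    refine Finset.prod_ne_zero_iff.2 fun e _ => ?_
    simp [phiS, (hpos e).ne', X_ne_zero]
  have h1 := (mul_eq_zero.1 h0).resolve_left (pow_ne_zero k hm)
  rw [map_sub, sub_eq_zero, phiS_prod, phiS_prod] at h1
  have h2 : ∀ c : E → ℕ, eval (fun _ => (1 : ℂ))
      (piE E (∏ e : E, (X e : MvPolynomial E ℂ) ^ c e)) = 1 := by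
    intro c
    simp [piE, map_prod]
  have h3 := congrArg (eval (fun _ => (1 : ℂ))) h1
  rw [map_mul, map_mul, h2, h2, eval_C, eval_C, mul_one, mul_one] at h3
  rw [h3] at h1
  refine mul_left_cancel₀ ?_ h1
  rw [Ne, C_eq_zero]
  exact Finset.prod_ne_zero_iff.2 fun e _ => pow_ne_zero _ (by simp [(hpos e).ne'])
end

section
/- Let E ⊆ Fin v × Fin f be a support pattern and d a natural number, and suppose there exists a point s : E → ℝ with s e > 0 for all e ∈ E at which every (d+2)-minor of S(x) vanishes. If I(E,d) is a pure difference binomial ideal, i.e. I(E,d) is generated by binomials of the form (∏_e x_e^{a e}) − (∏_e x_e^{b e}) with a, b : E → ℕ, then I(E,d) ⊆ T(E). -/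
open MvPolynomial

variable {v f : ℕ}

/-- If there is a positive real point at which every `(d+2)`-minor of the symbolic slack matrix
vanishes, and the slack ideal is a pure difference binomial ideal, then the slack ideal is
contained in the toric ideal of the non-incidence graph. -/
theorem stmt7 (v f d : ℕ) (E : Set (Fin v × Fin f)) (s : E → ℝ)
    (hpos : ∀ e, 0 < s e)
    (hvan : ∀ (ρ : Fin (d + 2) → Fin v) (σ : Fin (d + 2) → Fin f),
      Function.Injective ρ → Function.Injective σ →
      eval (fun e => (s e : ℂ)) ((symbMat E).submatrix ρ σ).det = 0)
    (hbin : ∃ B : Set (MvPolynomial E ℂ),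
      (∀ p ∈ B, ∃ a b : E → ℕ,
        p = (∏ᶠ e : E, (X e : MvPolynomial E ℂ) ^ a e)
            - (∏ᶠ e : E, (X e : MvPolynomial E ℂ) ^ b e)) ∧
      slackIdeal E d = Ideal.span B) :
    slackIdeal E d ≤ RingHom.ker (piE E) := by
  classical
  obtain ⟨B, hB, hspan⟩ := hbin
  -- the scaled map x_e ↦ s_e y_i z_j
  let φ : MvPolynomial E ℂ →ₐ[ℂ] MvPolynomial (Fin v ⊕ Fin f) ℂ :=
    aeval fun e => C (s e : ℂ) * (X (Sum.inl e.1.1) * X (Sum.inr e.1.2))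
  have hφX : ∀ e : E, φ (X e) = C (s e : ℂ) * (X (Sum.inl e.1.1) * X (Sum.inr e.1.2)) :=
    fun e => by simp [φ]
  have hπX : ∀ e : E, piE E (X e) = X (Sum.inl e.1.1) * X (Sum.inr e.1.2) :=
    fun e => by simp [piE]
  have hs0 : ∀ e, (s e : ℂ) ≠ 0 := fun e => by exact_mod_cast (hpos e).ne'
  have hminor : ∀ p ∈ minorIdeal E d, φ p = 0 := by
    intro p hp
    have hle : minorIdeal E d ≤ RingHom.ker φ := by
      unfold minorIdeal
      rw [Ideal.span_le]
      rintro _ ⟨ρ, σ, hρ, hσ, rfl⟩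
      show φ _ = 0
      rw [AlgHom.map_det]
      have hmat : φ.mapMatrix ((symbMat E).submatrix ρ σ) =
          Matrix.of fun i j => X (Sum.inl (ρ i)) * (Matrix.of fun i j => X (Sum.inr (σ j)) *
            (((C : ℂ →+* MvPolynomial (Fin v ⊕ Fin f) ℂ).comp
              (eval (fun e => (s e : ℂ)))).mapMatrix ((symbMat E).submatrix ρ σ)) i j) i j := by
        ext1 i j
        simp only [AlgHom.mapMatrix_apply, RingHom.mapMatrix_apply, Matrix.map_apply,
          Matrix.submatrix_apply, Matrix.of_apply, symbMat]
        split_ifs with h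
        · rw [hφX]; simp; ring
        · simp
      rw [hmat, Matrix.det_mul_column, Matrix.det_mul_row, ← RingHom.map_det,
        RingHom.comp_apply, hvan ρ σ hρ hσ]
      simp
    exact hle hp
  have hslack : ∀ p ∈ slackIdeal E d, φ p = 0 := by
    rintro p ⟨k, hk⟩
    have h := hminor _ hk
    rw [map_mul, map_pow] at h
    refine (mul_eq_zero.mp h).resolve_left (pow_ne_zero _ ?_)
    rw [finprod_eq_prod_of_fintype, map_prod]
    refine Finset.prod_ne_zero_iff.mpr fun e _ => ?_
    rw [hφX]
    exact mul_ne_zero (by simpa using hs0 e) (mul_ne_zero (X_ne_zero _) (X_ne_zero _))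
  have hmon : ∀ a : E → ℕ, φ (∏ e : E, (X e : MvPolynomial E ℂ) ^ a e) =
      C (∏ e : E, (s e : ℂ) ^ a e) * piE E (∏ e : E, (X e : MvPolynomial E ℂ) ^ a e) := by
    intro a
    simp only [map_prod, map_pow, hφX, hπX, mul_pow, Finset.prod_mul_distrib]
  have hone : ∀ a : E → ℕ,
      eval (fun _ => (1 : ℂ)) (piE E (∏ e : E, (X e : MvPolynomial E ℂ) ^ a e)) = 1 := by
    intro a
    simp only [map_prod, map_pow, hπX, map_mul, eval_X, one_pow, mul_one, Finset.prod_const_one]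
  rw [hspan, Ideal.span_le]
  intro p hp
  have h0 : φ p = 0 := hslack p (by rw [hspan]; exact Ideal.subset_span hp)
  obtain ⟨a, b, rfl⟩ := hB p hp
  rw [finprod_eq_prod_of_fintype, finprod_eq_prod_of_fintype] at h0 ⊢
  show piE E _ = 0
  rw [map_sub, hmon, hmon] at h0
  have h1 := congrArg (eval (fun _ => (1 : ℂ))) h0
  rw [map_sub, map_mul, map_mul, hone, hone, eval_C, eval_C, map_zero, mul_one, mul_one,
    sub_eq_zero] at h1
  rw [h1, ← mul_sub, ← map_sub] at h0
  refine (mul_eq_zero.mp h0).resolve_left ?_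
  rw [C_eq_zero]
  exact Finset.prod_ne_zero_iff.mpr fun e _ => pow_ne_zero _ (hs0 e)
end

section
/- Let M : Matrix (Fin v) (Fin f) ℝ and let F ⊆ Fin v × Fin f be a set of index pairs such that M i j > 0 for every (i,j) ∈ F and such that F is acyclic as an edge set of the bipartite graph on Fin v ⊕ Fin f (the simple graph in which Sum.inl i is adjacent to Sum.inr j iff (i,j) ∈ F contains no cycle, i.e. is a forest). Then there exist r : Fin v → ℝ and c : Fin f → ℝ with r i > 0 and c j > 0 for all i, j, such that r i * M i j * c j = 1 for every (i,j) ∈ F. (This is the scaling lemma: the rows and columns of a slack matrix can be scaled so that all entries indexed by the edges of a maximal spanning forest of the non-incidence graph equal 1.) -/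
/-- The bipartite simple graph on `Fin v ⊕ Fin f` whose edges are given by a set of index
pairs `F ⊆ Fin v × Fin f`: `Sum.inl i` is adjacent to `Sum.inr j` iff `(i,j) ∈ F`. -/
def bipGraph {v f : ℕ} (F : Set (Fin v × Fin f)) : SimpleGraph (Fin v ⊕ Fin f) :=
  SimpleGraph.fromRel fun x y => ∃ p ∈ F, x = Sum.inl p.1 ∧ y = Sum.inr p.2

theorem bipGraph_adj_iff {v f : ℕ} (F : Set (Fin v × Fin f)) (i : Fin v) (j : Fin f) :
    (bipGraph F).Adj (Sum.inl i) (Sum.inr j) ↔ (i, j) ∈ F := by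
  simp [bipGraph, SimpleGraph.fromRel_adj]

theorem bipGraph_mono {v f : ℕ} {F G : Set (Fin v × Fin f)} (h : F ⊆ G) :
    bipGraph F ≤ bipGraph G := by
  intro x y hxy
  simp only [bipGraph, SimpleGraph.fromRel_adj] at hxy ⊢
  refine ⟨hxy.1, hxy.2.imp ?_ ?_⟩
  · rintro ⟨p, hp, hh⟩
    exact ⟨p, h hp, hh⟩
  · rintro ⟨p, hp, hh⟩
    exact ⟨p, h hp, hh⟩

theorem bipGraph_not_reachable {v f : ℕ} {F : Set (Fin v × Fin f)} {a : Fin v × Fin f}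
    (ha : a ∉ F) (hacyc : (bipGraph (insert a F)).IsAcyclic) :
    ¬ (bipGraph F).Reachable (Sum.inl a.1) (Sum.inr a.2) := by
  have hadj : (bipGraph (insert a F)).Adj (Sum.inl a.1) (Sum.inr a.2) := by
    rw [bipGraph_adj_iff]
    exact Set.mem_insert _ _
  have hb := SimpleGraph.isAcyclic_iff_forall_adj_isBridge.1 hacyc hadj
  rw [SimpleGraph.isBridge_iff] at hb
  intro hr
  refine hb (hr.mono ?_)
  intro x y hxy
  rw [SimpleGraph.deleteEdges_adj]
  refine ⟨bipGraph_mono (Set.subset_insert _ _) hxy, ?_⟩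
  intro he
  have he' : (s(x, y) : Sym2 _) = s(Sum.inl a.1, Sum.inr a.2) := by simpa using he
  have h2 : (bipGraph F).Adj (Sum.inl a.1) (Sum.inr a.2) := by
    rw [← SimpleGraph.mem_edgeSet, ← he']
    exact hxy
  exact ha ((bipGraph_adj_iff F _ _).1 h2)

/-- Scaling lemma: if `F` is a set of positions at which `M` is positive and `F` is a forest
(acyclic edge set) in the associated bipartite graph, then the rows and columns of `M` can be
scaled by positive reals so that all entries indexed by `F` become `1`. -/
theorem stmt8 (v f : ℕ) (M : Matrix (Fin v) (Fin f) ℝ) (F : Set (Fin v × Fin f))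
    (hpos : ∀ p ∈ F, 0 < M p.1 p.2)
    (hacyc : (bipGraph F).IsAcyclic) :
    ∃ (r : Fin v → ℝ) (c : Fin f → ℝ),
      (∀ i, 0 < r i) ∧ (∀ j, 0 < c j) ∧
      ∀ p ∈ F, r p.1 * M p.1 p.2 * c p.2 = 1 := by
  classical
  have hfin : F.Finite := Set.toFinite F
  induction F, hfin using Set.Finite.induction_on with
  | empty => exact ⟨fun _ => 1, fun _ => 1, by simp, by simp, by simp⟩
  | @insert a F ha hF ih =>
    obtain ⟨r, c, hr, hc, h⟩ := ih (fun p hp => hpos p (Set.mem_insert_of_mem _ hp))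
      (hacyc.anti (bipGraph_mono (Set.subset_insert _ _)))
    have hn := bipGraph_not_reachable ha hacyc
    have hM := hpos a (Set.mem_insert _ _)
    obtain ⟨t, ht⟩ : ∃ t, t = r a.1 * M a.1 a.2 * c a.2 := ⟨_, rfl⟩
    have ht0 : 0 < t := by
      rw [ht]
      exact mul_pos (mul_pos (hr _) hM) (hc _)
    refine ⟨fun i => if (bipGraph F).Reachable (Sum.inl a.1) (Sum.inl i) then r i / t else r i,
      fun j => if (bipGraph F).Reachable (Sum.inl a.1) (Sum.inr j) then c j * t else c j,
      ?_, ?_, ?_⟩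
    · intro i
      have := hr i
      dsimp only
      split_ifs <;> positivity
    · intro j
      have := hc j
      dsimp only
      split_ifs <;> positivity
    · intro p hp
      rcases Set.mem_insert_iff.1 hp with rfl | hp
      · dsimp only
        rw [if_pos (SimpleGraph.Reachable.refl _), if_neg hn]
        have : r p.1 / t * M p.1 p.2 * c p.2 = (r p.1 * M p.1 p.2 * c p.2) / t := by ring
        rw [this, ← ht, div_self ht0.ne']
      · have hadj := (bipGraph_adj_iff F p.1 p.2).2 hp
        have hiff : (bipGraph F).Reachable (Sum.inl a.1) (Sum.inl p.1) ↔
            (bipGraph F).Reachable (Sum.inl a.1) (Sum.inr p.2) :=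
          ⟨fun q => q.trans hadj.reachable, fun q => q.trans hadj.symm.reachable⟩
        have h1 := h p hp
        dsimp only
        by_cases hh : (bipGraph F).Reachable (Sum.inl a.1) (Sum.inl p.1)
        · rw [if_pos hh, if_pos (hiff.1 hh), ← h1]
          field_simp
        · rw [if_neg hh, if_neg (fun q => hh (hiff.2 q)), h1]
end

section
/- Let E ⊆ Fin v × Fin f and let S(x) be the symbolic matrix of E. For any k : ℕ and any injections ρ : Fin k → Fin v and σ : Fin k → Fin f, one has π(det(S(x).submatrix ρ σ)) = c • (∏_{l} y_{ρ l}) * (∏_{l} z_{σ l}), where c ∈ ℂ is the value of det(S(x).submatrix ρ σ) at the all-ones point (x_e ↦ 1 for all e ∈ E). In particular, if the minor vanishes at the all-ones point then it lies in T(E) = ker π. -/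
open MvPolynomial

variable {v f : ℕ}

/-- Under the map `π : x_{(i,j)} ↦ y_i z_j`, any `k×k` minor of the symbolic slack matrix maps
to a scalar multiple of the monomial `∏ y_{ρ l} ∏ z_{σ l}`, the scalar being the value of the
minor at the all-ones point. In particular, a minor vanishing at the all-ones point lies in
`T(E) = ker π`. -/
theorem stmt11 (v f : ℕ) (E : Set (Fin v × Fin f)) (k : ℕ)
    (ρ : Fin k → Fin v) (σ : Fin k → Fin f)
    (hρ : Function.Injective ρ) (hσ : Function.Injective σ) :
    piE E (((symbMat E).submatrix ρ σ).det) =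
      (eval (fun _ : E => (1 : ℂ)) ((symbMat E).submatrix ρ σ).det) •
        ((∏ l, (X (Sum.inl (ρ l)) : MvPolynomial (Fin v ⊕ Fin f) ℂ)) *
          ∏ l, (X (Sum.inr (σ l)) : MvPolynomial (Fin v ⊕ Fin f) ℂ)) ∧
    (eval (fun _ : E => (1 : ℂ)) ((symbMat E).submatrix ρ σ).det = 0 →
      ((symbMat E).submatrix ρ σ).det ∈ RingHom.ker (piE E)) := by
  have key : piE E (((symbMat E).submatrix ρ σ).det) =
      (eval (fun _ : E => (1 : ℂ)) ((symbMat E).submatrix ρ σ).det) •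
        ((∏ l, (X (Sum.inl (ρ l)) : MvPolynomial (Fin v ⊕ Fin f) ℂ)) *
          ∏ l, (X (Sum.inr (σ l)) : MvPolynomial (Fin v ⊕ Fin f) ℂ)) := by
    have hM : (piE E).mapMatrix ((symbMat E).submatrix ρ σ) =
        Matrix.diagonal (fun l => (X (Sum.inl (ρ l)) : MvPolynomial (Fin v ⊕ Fin f) ℂ)) *
        (C : ℂ →+* MvPolynomial (Fin v ⊕ Fin f) ℂ).mapMatrix
          ((eval (fun _ : E => (1 : ℂ))).mapMatrix ((symbMat E).submatrix ρ σ)) *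
        Matrix.diagonal (fun l => (X (Sum.inr (σ l)) : MvPolynomial (Fin v ⊕ Fin f) ℂ)) := by
      ext1 i j
      rw [Matrix.mul_diagonal, Matrix.diagonal_mul]
      simp only [AlgHom.mapMatrix_apply, RingHom.mapMatrix_apply, Matrix.map_apply,
        Matrix.submatrix_apply, symbMat]
      split_ifs with h
      · simp [piE]
      · simp
    rw [AlgHom.map_det, hM, Matrix.det_mul, Matrix.det_mul, Matrix.det_diagonal,
      Matrix.det_diagonal, ← RingHom.map_det, ← RingHom.map_det, smul_eq_C_mul]
    ring
  refine ⟨key, fun h => ?_⟩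
  rw [RingHom.mem_ker, key, h, zero_smul]
end

section
/- Let K be a simple graph on a vertex type V and let G be the subdivision of K: the simple graph on V ⊕ K.edgeSet in which Sum.inl u is adjacent to Sum.inr e if and only if u is an endpoint of the edge e, with no other adjacencies. Then every cycle in G is chordless (induced): if a cycle C in G visits two vertices w and w' that are adjacent in G, then the edge between w and w' is an edge of C. -/
/-- The subdivision of a simple graph `K`: the bipartite simple graph on `V ⊕ K.edgeSet` in
which `Sum.inl u` is adjacent to `Sum.inr e` iff `u` is an endpoint of the edge `e`, and there
are no other adjacencies. -/
def subdivision {V : Type*} (K : SimpleGraph V) : SimpleGraph (V ⊕ K.edgeSet) :=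
  SimpleGraph.fromRel fun x y =>
    ∃ (u : V) (e : K.edgeSet), x = Sum.inl u ∧ y = Sum.inr e ∧ u ∈ (e : Sym2 V)

theorem subdivision_aux {V : Type*} (K : SimpleGraph V) (x : V ⊕ K.edgeSet)
    (C : (subdivision K).Walk x x) (hC : C.IsCycle) (u : V) (e : K.edgeSet)
    (hu : u ∈ (e : Sym2 V)) (he : Sum.inr e ∈ C.support) :
    s(Sum.inl u, Sum.inr e) ∈ C.edges := by
  have h2 := hC.ncard_neighborSet_toSubgraph_eq_two he
  obtain ⟨b, hb⟩ := Sym2.mem_iff_exists.mp hu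
  have hsub : C.toSubgraph.neighborSet (Sum.inr e) ⊆ {Sum.inl u, Sum.inl b} := by
    intro y hy
    have hy' : (subdivision K).Adj (Sum.inr e) y := C.toSubgraph.adj_sub hy
    rw [subdivision, SimpleGraph.fromRel_adj] at hy'
    obtain ⟨-, ⟨a, f, h, -⟩ | ⟨a, f, h, h', h''⟩⟩ := hy'
    · cases h
    · cases h'
      subst h
      rw [hb, Sym2.mem_iff] at h''
      rcases h'' with rfl | rfl <;> simp
  have heq := Set.eq_of_subset_of_ncard_le hsub (by
    rw [h2]; exact (Set.ncard_insert_le _ _).trans (by simp)) (Set.toFinite _)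
  have hmem : (Sum.inl u : V ⊕ K.edgeSet) ∈ C.toSubgraph.neighborSet (Sum.inr e) := by
    rw [heq]; simp
  have hA : C.toSubgraph.Adj (Sum.inr e) (Sum.inl u) := hmem
  rw [← SimpleGraph.Walk.mem_edges_toSubgraph, SimpleGraph.Subgraph.mem_edgeSet]
  exact hA.symm

/-- Every cycle in the subdivision of a simple graph is chordless (induced): if a cycle `C`
visits two vertices `w` and `w'` that are adjacent in the subdivision, then the edge between
`w` and `w'` is an edge of `C`. -/
theorem stmt15 {V : Type*} (K : SimpleGraph V) (x : V ⊕ K.edgeSet)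
    (C : (subdivision K).Walk x x) (hC : C.IsCycle)
    (w w' : V ⊕ K.edgeSet) (hw : w ∈ C.support) (hw' : w' ∈ C.support)
    (hadj : (subdivision K).Adj w w') :
    s(w, w') ∈ C.edges := by
  rw [subdivision, SimpleGraph.fromRel_adj] at hadj
  obtain ⟨-, ⟨u, e, rfl, rfl, hu⟩ | ⟨u, e, rfl, rfl, hu⟩⟩ := hadj
  · exact subdivision_aux K x C hC u e hu hw'
  · rw [Sym2.eq_swap]
    exact subdivision_aux K x C hC u e hu hw
end
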